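/- arXiv:2507.08503 — 2 statements merged into one kernel-verified Lean document; each statement's English description precedes it below -/
import Mathlib

section
/- If G is a connected finite simple graph of order n with 2·ι_g(G) = n, then G is isomorphic to the complete graph K_2 or to the cycle C_6; conversely, ι_g(K_2) = 1 and ι_g(C_6) = 3, so both graphs attain equality. -/
open SimpleGraph

variable {V : Type*}

/-- The closed neighborhood `N_G[X]` of a set `X` of vertices: all vertices that are in `X`
or adjacent to a vertex of `X`. -/
def closedNbhdSet (G : SimpleGraph V) (X : Set V) : Set V :=
  {u | u ∈ X ∨ ∃ x ∈ X, G.Adj x u}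

/-- A vertex `v` is playable with respect to the set `X` of already selected vertices if the
closed neighborhood of `v` contains a vertex `u ∉ N_G[X]` having a neighbor `w ∉ N_G[X]`,
i.e. `v` dominates a vertex of a nontrivial component of `G - N_G[X]`. -/
def IsPlayable (G : SimpleGraph V) (X : Set V) (v : V) : Prop :=
  ∃ u, (u = v ∨ G.Adj v u) ∧ u ∉ closedNbhdSet G X ∧
    ∃ w, G.Adj u w ∧ w ∉ closedNbhdSet G X

open Classical in
/-- The optimal-play value (number of further selected vertices) of the isolation game
position with given fuel, player to move (`true` = Dominator, the minimizer;
`false` = Staller, the maximizer) and set `X` of already selected vertices. -/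
noncomputable def isoGameVal (G : SimpleGraph V) : ℕ → Bool → Set V → ℕ
  | 0, _, _ => 0
  | (k + 1), isDom, X =>
    if ∃ v, IsPlayable G X v then
      (if isDom then sInf else sSup)
        {n : ℕ | ∃ v, IsPlayable G X v ∧ n = isoGameVal G k (!isDom) (insert v X) + 1}
    else 0

/-- The game isolation number `ι_g(G)`: the number of vertices selected in the isolation
game on `G` when Dominator moves first and both players play optimally.  (A game on a
graph with `n` vertices lasts at most `n` moves, so fuel `Fintype.card V` suffices.) -/
noncomputable def iotaGame (G : SimpleGraph V) [Fintype V] : ℕ :=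
  isoGameVal G (Fintype.card V) true ∅

/-- The Staller-start game isolation number `ι_g'(G)`: the number of vertices selected in
the isolation game on `G` when Staller moves first and both players play optimally. -/
noncomputable def iotaGame' (G : SimpleGraph V) [Fintype V] : ℕ :=
  isoGameVal G (Fintype.card V) false ∅

/-- The vertices of the nontrivial components of `G - N_G[X]`. -/
def activeSet (G : SimpleGraph V) (X : Set V) : Set V :=
  {u | u ∉ closedNbhdSet G X ∧ ∃ w, G.Adj u w ∧ w ∉ closedNbhdSet G X}

section Active

variable {G : SimpleGraph V} {X : Set V} {u v w : V}

theorem mem_closedNbhdSet_insert :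
    u ∈ closedNbhdSet G (insert v X) ↔ (u = v ∨ G.Adj v u) ∨ u ∈ closedNbhdSet G X := by
  simp only [closedNbhdSet, Set.mem_ofPred_eq, Set.mem_insert_iff, exists_eq_or_imp]
  tauto

theorem closedNbhdSet_empty : closedNbhdSet G ∅ = ∅ := by
  simp [closedNbhdSet]

theorem isPlayable_iff : IsPlayable G X v ↔ ∃ u ∈ activeSet G X, u = v ∨ G.Adj v u := by
  unfold IsPlayable activeSet
  simp only [Set.mem_ofPred_eq]
  constructor
  · rintro ⟨u, h1, h2, h3⟩
    exact ⟨u, ⟨h2, h3⟩, h1⟩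
  · rintro ⟨u, ⟨h2, h3⟩, h1⟩
    exact ⟨u, h1, h2, h3⟩

theorem isPlayable_of_mem_activeSet (h : v ∈ activeSet G X) : IsPlayable G X v :=
  isPlayable_iff.2 ⟨v, h, Or.inl rfl⟩

theorem mem_activeSet_of_adj (h : G.Adj u w) (hu : u ∉ closedNbhdSet G X)
    (hw : w ∉ closedNbhdSet G X) : u ∈ activeSet G X :=
  ⟨hu, w, h, hw⟩

theorem exists_adj_mem_activeSet (h : u ∈ activeSet G X) : ∃ w ∈ activeSet G X, G.Adj u w := by
  obtain ⟨hu, w, huw, hw⟩ := h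
  exact ⟨w, mem_activeSet_of_adj huw.symm hw hu, huw⟩

theorem activeSet_insert_subset : activeSet G (insert v X) ⊆ activeSet G X := by
  rintro u ⟨hu, w, huw, hw⟩
  rw [mem_closedNbhdSet_insert] at hu hw
  exact ⟨fun h => hu (Or.inr h), w, huw, fun h => hw (Or.inr h)⟩

theorem notMem_activeSet_insert (h : u = v ∨ G.Adj v u) : u ∉ activeSet G (insert v X) :=
  fun hu => hu.1 (mem_closedNbhdSet_insert.2 (Or.inl h))

theorem ncard_activeSet_insert_add_le [Finite V] {T : Set V} (hT : T ⊆ activeSet G X)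
    (hT' : ∀ t ∈ T, t ∉ activeSet G (insert v X)) :
    (activeSet G (insert v X)).ncard + T.ncard ≤ (activeSet G X).ncard := by
  rw [← Set.ncard_union_eq (Set.disjoint_right.2 hT')]
  exact Set.ncard_le_ncard (Set.union_subset activeSet_insert_subset hT)

theorem ncard_activeSet_insert_add_one_le [Finite V] (h : IsPlayable G X v) :
    (activeSet G (insert v X)).ncard + 1 ≤ (activeSet G X).ncard := by
  obtain ⟨u, hu, huv⟩ := isPlayable_iff.1 h
  have := ncard_activeSet_insert_add_le (v := v) (Set.singleton_subset_iff.2 hu)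
    (by rintro t rfl; exact notMem_activeSet_insert huv)
  rwa [Set.ncard_singleton] at this

theorem activeSet_empty (h : ∀ v, ∃ w, G.Adj v w) : activeSet G ∅ = Set.univ := by
  ext v
  simpa [activeSet, closedNbhdSet_empty] using h v

end Active

section Value

variable {G : SimpleGraph V} {X : Set V} {k m : ℕ} {v : V}

theorem isoGameVal_of_not_exists (b : Bool) (h : ¬∃ v, IsPlayable G X v) :
    isoGameVal G k b X = 0 := by
  cases k with
  | zero => rfl
  | succ k => rw [isoGameVal, if_neg h]

theorem isoGameVal_dominator_le (h : IsPlayable G X v) :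
    isoGameVal G (k + 1) true X ≤ isoGameVal G k false (insert v X) + 1 := by
  rw [isoGameVal, if_pos ⟨v, h⟩]
  exact Nat.sInf_le ⟨v, h, rfl⟩

theorem le_isoGameVal_dominator (hX : ∃ v, IsPlayable G X v)
    (h : ∀ v, IsPlayable G X v → m ≤ isoGameVal G k false (insert v X) + 1) :
    m ≤ isoGameVal G (k + 1) true X := by
  rw [isoGameVal, if_pos hX]
  obtain ⟨v, hv⟩ := hX
  refine le_csInf ⟨_, v, hv, rfl⟩ ?_
  rintro n ⟨v, hv, rfl⟩
  exact h v hv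

theorem isoGameVal_staller_le
    (h : ∀ v, IsPlayable G X v → isoGameVal G k true (insert v X) + 1 ≤ m) :
    isoGameVal G (k + 1) false X ≤ m := by
  by_cases hX : ∃ v, IsPlayable G X v
  · rw [isoGameVal, if_pos hX]
    obtain ⟨v, hv⟩ := hX
    refine csSup_le ⟨_, v, hv, rfl⟩ ?_
    rintro n ⟨v, hv, rfl⟩
    exact h v hv
  · rw [isoGameVal_of_not_exists _ hX]
    exact Nat.zero_le _

theorem isoGameVal_le_fuel (b : Bool) : isoGameVal G k b X ≤ k := by
  induction k generalizing b X with
  | zero => exact le_rfl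
  | succ k ih =>
    cases b with
    | false => exact isoGameVal_staller_le fun v _ => Nat.succ_le_succ (ih true)
    | true =>
      by_cases hX : ∃ v, IsPlayable G X v
      · obtain ⟨v, hv⟩ := hX
        exact (isoGameVal_dominator_le hv).trans (Nat.succ_le_succ (ih false))
      · rw [isoGameVal_of_not_exists _ hX]
        exact Nat.zero_le _

theorem le_isoGameVal_staller (h : IsPlayable G X v) :
    isoGameVal G k true (insert v X) + 1 ≤ isoGameVal G (k + 1) false X := by
  rw [isoGameVal, if_pos ⟨v, h⟩]
  refine le_csSup ⟨k + 1, ?_⟩ ⟨v, h, rfl⟩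
  rintro n ⟨w, -, rfl⟩
  exact Nat.succ_le_succ (isoGameVal_le_fuel _)

end Value

section Bounds

variable [Finite V] {G : SimpleGraph V} {X : Set V}

/-- When all nontrivial components are copies of `K_2`, every move removes two vertices. -/
theorem two_mul_isoGameVal_le_of_matching (k : ℕ) (b : Bool)
    (h : ∀ u ∈ activeSet G X, ∀ w ∈ activeSet G X, ∀ w' ∈ activeSet G X,
      G.Adj u w → G.Adj u w' → w = w') :
    2 * isoGameVal G k b X ≤ (activeSet G X).ncard := by
  induction k generalizing b X with
  | zero => exact Nat.zero_le _
  | succ k ih =>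
    have key : ∀ v b, IsPlayable G X v →
        2 * (isoGameVal G k b (insert v X) + 1) ≤ (activeSet G X).ncard := by
      intro v b hv
      obtain ⟨u, hu, huv⟩ := isPlayable_iff.1 hv
      obtain ⟨w, hw, huw⟩ := exists_adj_mem_activeSet hu
      have hT := ncard_activeSet_insert_add_le (v := v) (T := {u, w})
        (Set.insert_subset hu (Set.singleton_subset_iff.2 hw)) (by
          rintro t (rfl | rfl)
          · exact notMem_activeSet_insert huv
          · intro ht
            obtain ⟨x, hx, htx⟩ := exists_adj_mem_activeSet ht
            obtain rfl := h t hw u hu x (activeSet_insert_subset hx) huw.symm htx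
            exact notMem_activeSet_insert huv hx)
      rw [Set.ncard_pair huw.ne] at hT
      have := ih (X := insert v X) b fun u hu w hw w' hw' =>
        h u (activeSet_insert_subset hu) w (activeSet_insert_subset hw) w'
          (activeSet_insert_subset hw')
      omega
    by_cases hX : ∃ v, IsPlayable G X v
    · cases b with
      | true =>
        obtain ⟨v, hv⟩ := hX
        have h1 := isoGameVal_dominator_le (k := k) hv
        have h2 := key v false hv
        omega
      | false =>
        have := isoGameVal_staller_le (G := G) (X := X) (k := k)
          (m := (activeSet G X).ncard / 2) fun v hv => by
            have := key v true hv
            omega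
        omega
    · rw [isoGameVal_of_not_exists _ hX]
      exact Nat.zero_le _

theorem two_mul_isoGameVal_le (k : ℕ) (X : Set V) :
    2 * isoGameVal G k true X ≤ (activeSet G X).ncard ∧
      2 * isoGameVal G k false X ≤ (activeSet G X).ncard + 1 := by
  induction k generalizing X with
  | zero => exact ⟨Nat.zero_le _, Nat.zero_le _⟩
  | succ k ih =>
    constructor
    · by_cases h : ∀ u ∈ activeSet G X, ∀ w ∈ activeSet G X, ∀ w' ∈ activeSet G X,
        G.Adj u w → G.Adj u w' → w = w'
      · exact two_mul_isoGameVal_le_of_matching _ _ h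
      · push Not at h
        obtain ⟨u, hu, w, hw, w', hw', huw, huw', hne⟩ := h
        have hT := ncard_activeSet_insert_add_le (v := u) (T := {u, w, w'})
          (by rintro t (rfl | rfl | rfl) <;> assumption)
          (by rintro t (rfl | rfl | rfl) <;> apply notMem_activeSet_insert <;> simp [*])
        rw [Set.ncard_eq_three.2 ⟨u, w, w', huw.ne, huw'.ne, hne, rfl⟩] at hT
        have h1 := isoGameVal_dominator_le (k := k) (isPlayable_of_mem_activeSet hu)
        have h2 := (ih (insert u X)).2
        omega
    · have := isoGameVal_staller_le (G := G) (X := X) (k := k)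
        (m := ((activeSet G X).ncard + 1) / 2) fun v hv => by
          have h1 := ncard_activeSet_insert_add_one_le hv
          have h2 := (ih (insert v X)).1
          omega
      omega

theorem two_mul_isoGameVal_lt {v : V} (k : ℕ)
    (h : (activeSet G (insert v X)).ncard + 4 ≤ (activeSet G X).ncard)
    (hv : v ∈ activeSet G X) :
    2 * isoGameVal G k true X < (activeSet G X).ncard := by
  cases k with
  | zero =>
    rw [isoGameVal]
    omega
  | succ k =>
    have h1 := isoGameVal_dominator_le (k := k) (isPlayable_of_mem_activeSet hv)
    have h2 := (two_mul_isoGameVal_le (G := G) k (insert v X)).2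
    omega

end Bounds

section Structure

variable {G : SimpleGraph V}

theorem SimpleGraph.Connected.eq_univ_of_adj_closed (hG : G.Connected) {S : Set V}
    (hne : S.Nonempty) (h : ∀ x ∈ S, ∀ y, G.Adj x y → y ∈ S) : S = Set.univ := by
  obtain ⟨s, hs⟩ := hne
  refine Set.eq_univ_of_forall fun x => ?_
  obtain ⟨p⟩ := hG.preconnected s x
  induction p with
  | nil => exact hs
  | cons hadj _ ih => exact ih (h _ hs _ hadj)

theorem exists_nonbacktracking (hmin : ∀ v u, G.Adj v u → ∃ w, w ≠ u ∧ G.Adj v w)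
    {a b : V} (hab : G.Adj a b) :
    ∃ y : ℕ → V, y 0 = a ∧ y 1 = b ∧ (∀ i, G.Adj (y i) (y (i + 1))) ∧
      ∀ i, y (i + 2) ≠ y i := by
  choose f hf1 hf2 using hmin
  let step : {p : V × V // G.Adj p.1 p.2} → {p : V × V // G.Adj p.1 p.2} := fun p =>
    ⟨(p.1.2, f p.1.2 p.1.1 p.2.symm), hf2 _ _ _⟩
  let z : ℕ → {p : V × V // G.Adj p.1 p.2} := fun n => Nat.rec ⟨(a, b), hab⟩ (fun _ => step) n
  exact ⟨fun n => (z n).1.1, rfl, rfl, fun i => (z i).2, fun i => hf1 _ _ _⟩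

theorem nonbacktracking_injective [Fintype V] (hG : G.Connected)
    (hmax : ∀ v a b c, G.Adj v a → G.Adj v b → G.Adj v c → a ≠ b → c = a ∨ c = b)
    {y : ℕ → V} (hadj : ∀ i, G.Adj (y i) (y (i + 1))) (hne : ∀ i, y (i + 2) ≠ y i)
    {m : ℕ} (hm : m ≤ Fintype.card V) {i j : ℕ} (hij : i < j) (hj : j < m) : y i ≠ y j := by
  have hnb : ∀ i x, G.Adj (y (i + 1)) x → x = y (i + 2) ∨ x = y i := fun i x hx =>
    hmax _ _ _ _ (hadj (i + 1)) (hadj i).symm hx (hne i)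
  induction m generalizing i j with
  | zero => omega
  | succ m ih =>
    have ih' := @ih (by omega)
    rcases Nat.lt_succ_iff_lt_or_eq.1 hj with hj' | rfl
    · exact ih' hij hj'
    obtain _ | _ | l := j
    · omega
    · obtain rfl : i = 0 := by omega
      exact (hadj 0).ne
    intro heq
    have hadj' : G.Adj (y i) (y (l + 1)) := heq ▸ (hadj (l + 1)).symm
    by_cases h1 : i = l + 1
    · subst h1
      exact hadj'.ne rfl
    by_cases h2 : i = l
    · subst h2
      exact hne _ heq.symm
    obtain _ | i := i
    · have hS : y '' Set.Iio (l + 2) = Set.univ := by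
        refine hG.eq_univ_of_adj_closed ⟨_, 0, by simp, rfl⟩ ?_
        rintro _ ⟨j, hj, rfl⟩ x hx
        simp only [Set.mem_Iio] at hj
        obtain _ | j := j
        · rcases hmax _ _ _ _ (hadj 0) hadj' hx (ih' (by omega) (by omega)) with rfl | rfl
          · exact ⟨1, by simp, rfl⟩
          · exact ⟨l + 1, by simp, rfl⟩
        · rcases hnb j x hx with rfl | rfl
          · by_cases hjl : j = l
            · subst hjl
              exact ⟨0, by simp, heq⟩
            · exact ⟨j + 2, by simp only [Set.mem_Iio]; omega, rfl⟩
          · exact ⟨j, by simp only [Set.mem_Iio]; omega, rfl⟩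
      have hc := Set.ncard_image_le (f := y) (Set.finite_Iio (l + 2))
      rw [hS, Set.ncard_univ, Nat.card_eq_fintype_card, ← Finset.coe_Iio,
        Set.ncard_coe_finset, Nat.card_Iio] at hc
      omega
    · rcases hnb i _ hadj' with h | h
      · exact ih' (i := i + 2) (j := l + 1) (by omega) (by omega) h.symm
      · exact ih' (i := i) (j := l + 1) (by omega) (by omega) h.symm

theorem nonempty_iso_cycleGraph_six [Fintype V] (hG : G.Connected)
    (hmax : ∀ v a b c, G.Adj v a → G.Adj v b → G.Adj v c → a ≠ b → c = a ∨ c = b)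
    {y : ℕ → V} (hadj : ∀ i, G.Adj (y i) (y (i + 1))) (hne : ∀ i, y (i + 2) ≠ y i)
    (hcard : Fintype.card V = 6) : Nonempty (G ≃g cycleGraph 6) := by
  have hinj : ∀ i j, i < j → j < 6 → y i ≠ y j := fun i j =>
    nonbacktracking_injective hG hmax hadj hne hcard.ge
  let f : Fin 6 → V := fun i => y i
  have hf : Function.Injective f := by
    intro i j h
    rcases lt_trichotomy i j with hij | hij | hij
    · exact absurd h (hinj _ _ hij j.2)
    · exact hij
    · exact absurd h.symm (hinj _ _ hij i.2)
  have hbij : Function.Bijective f :=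
    (Fintype.bijective_iff_injective_and_card f).2 ⟨hf, by simp [hcard]⟩
  have hlast : G.Adj (y 5) (y 0) := by
    obtain ⟨⟨j, hj⟩, hjy⟩ := hbij.2 (y 6)
    replace hjy : y j = y 6 := hjy
    obtain _ | j := j
    · exact hjy ▸ hadj 5
    · exfalso
      have h5 : G.Adj (y (j + 1)) (y 5) := hjy ▸ (hadj 5).symm
      by_cases h1 : j = 4
      · subst h1
        exact h5.ne rfl
      by_cases h2 : j = 3
      · subst h2
        exact hne 4 hjy.symm
      rcases hmax _ _ _ _ (hadj (j + 1)) (hadj j).symm h5 (hne j) with h | h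
      · exact hinj (j + 2) 5 (by omega) (by omega) h.symm
      · exact hinj j 5 (by omega) (by omega) h.symm
  have hsucc : ∀ i : Fin 6, G.Adj (f i) (f (i + 1)) := by
    intro i
    fin_cases i
    · exact hadj 0
    · exact hadj 1
    · exact hadj 2
    · exact hadj 3
    · exact hadj 4
    · exact hlast
  have hadd : ∀ i : Fin 6, f (i + 1) ≠ f (i - 1) := fun i h =>
    (by decide : ∀ i : Fin 6, i + 1 ≠ i - 1) i (hf h)
  refine ⟨(Iso.symm ⟨Equiv.ofBijective f hbij, ?_⟩)⟩
  intro i j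
  have hpred : G.Adj (f i) (f (i - 1)) := by
    simpa using (hsucc (i - 1)).symm
  have hc : ∀ i j : Fin 6, (cycleGraph 6).Adj i j ↔ j = i + 1 ∨ j = i - 1 := by decide
  rw [hc]
  simp only [Equiv.ofBijective_apply]
  constructor
  · intro h
    rcases hmax _ _ _ _ (hsucc i) hpred h (hadd i) with h | h
    · exact Or.inl (hf h)
    · exact Or.inr (hf h)
  · rintro (rfl | rfl)
    · exact hsucc i
    · exact hpred

end Structure

section Extremal

variable [Fintype V] {G : SimpleGraph V}

theorem adj_eq_or_eq_of_forall_lt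
    (huniv : activeSet G ∅ = Set.univ)
    (hno : ∀ v, Fintype.card V < (activeSet G {v}).ncard + 4)
    (v a b c : V) (ha : G.Adj v a) (hb : G.Adj v b) (hc : G.Adj v c) (hab : a ≠ b) :
    c = a ∨ c = b := by
  by_contra! h
  have hT := ncard_activeSet_insert_add_le (G := G) (X := ∅) (v := v) (T := {v, a, b, c})
    (huniv ▸ Set.subset_univ _)
    (by rintro t (rfl | rfl | rfl | rfl) <;> apply notMem_activeSet_insert <;> simp [*])
  rw [Set.ncard_insert_of_notMem (by simp [ha.ne, hb.ne, hc.ne]),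
    Set.ncard_eq_three.2 ⟨a, b, c, hab, h.1.symm, h.2.symm, rfl⟩, huniv, Set.ncard_univ,
    Nat.card_eq_fintype_card, insert_empty_eq] at hT
  have := hno v
  omega

theorem exists_ne_adj_of_forall_lt (hG : G.Connected) (h4 : 4 ≤ Fintype.card V)
    (huniv : activeSet G ∅ = Set.univ)
    (hno : ∀ v, Fintype.card V < (activeSet G {v}).ncard + 4)
    (v u : V) (huv : G.Adj v u) : ∃ w, w ≠ u ∧ G.Adj v w := by
  by_contra! hv
  have hleaf : ∀ x, G.Adj v x → x = u := fun x hx => by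
    by_contra h
    exact hv x h hx
  have hmax := adj_eq_or_eq_of_forall_lt huniv hno
  have hsmall : ∀ S : Set V, S.Nonempty → S.ncard < 4 → ∃ x ∈ S, ∃ y, G.Adj x y ∧ y ∉ S := by
    intro S hS hcard
    by_contra! h
    rw [hG.eq_univ_of_adj_closed hS h, Set.ncard_univ, Nat.card_eq_fintype_card] at hcard
    omega
  obtain ⟨w, huw, hwv⟩ : ∃ w, G.Adj u w ∧ w ≠ v := by
    obtain ⟨x, rfl | rfl, y, hxy, hy⟩ := hsmall {v, u} ⟨v, by simp⟩
      (by rw [Set.ncard_pair huv.ne]; omega)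
    · exact absurd (hleaf y hxy) (fun h => hy (by simp [h]))
    · exact ⟨y, hxy, fun h => hy (by simp [h])⟩
  have hvuw : ({v, u, w} : Set V).ncard = 3 :=
    Set.ncard_eq_three.2 ⟨v, u, w, huv.ne, hwv.symm, huw.ne, rfl⟩
  obtain ⟨x, hwx, hx⟩ : ∃ x, G.Adj w x ∧ x ∉ ({v, u, w} : Set V) := by
    obtain ⟨z, rfl | rfl | rfl, y, hzy, hy⟩ := hsmall {v, u, w} ⟨v, by simp⟩ (by omega)
    · exact absurd (hleaf y hzy) (fun h => hy (by simp [h]))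
    · rcases hmax _ _ _ _ huv.symm huw hzy hwv.symm with rfl | rfl <;> simp at hy
    · exact ⟨y, hzy, hy⟩
  have hT := ncard_activeSet_insert_add_le (G := G) (X := ∅) (v := w) (T := {x, v, u, w})
    (huniv ▸ Set.subset_univ _) (by
      rintro t (rfl | rfl | rfl | rfl)
      · exact notMem_activeSet_insert (Or.inr hwx)
      · intro ht
        obtain ⟨z, hz, htz⟩ := exists_adj_mem_activeSet ht
        obtain rfl := hleaf z htz
        exact notMem_activeSet_insert (Or.inr huw.symm) hz
      · exact notMem_activeSet_insert (Or.inr huw.symm)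
      · exact notMem_activeSet_insert (Or.inl rfl))
  rw [Set.ncard_insert_of_notMem hx, hvuw, huniv, Set.ncard_univ,
    Nat.card_eq_fintype_card, insert_empty_eq] at hT
  have := hno w
  omega

/-- On a cycle with at least eight vertices, Dominator can remove four vertices with her second
move after the first two moves have been made on adjacent vertices. -/
theorem two_mul_isoGameVal_adj_lt (hG : G.Connected)
    (hmax : ∀ v a b c, G.Adj v a → G.Adj v b → G.Adj v c → a ≠ b → c = a ∨ c = b)
    (hmin : ∀ v u, G.Adj v u → ∃ w, w ≠ u ∧ G.Adj v w)
    (hcard : 8 ≤ Fintype.card V) {v a : V} (hva : G.Adj v a) (k : ℕ) :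
    2 * isoGameVal G k true {a, v} < (activeSet G {a, v}).ncard := by
  obtain ⟨a', ha'v, haa'⟩ := hmin a v hva.symm
  obtain ⟨y, rfl, rfl, hadj, hne⟩ := exists_nonbacktracking hmin haa'.symm
  have hinj : ∀ i j, i < j → j < 8 → y i ≠ y j := fun i j =>
    nonbacktracking_injective hG hmax hadj hne hcard
  have hnb : ∀ i x, G.Adj (y (i + 1)) x → x = y (i + 2) ∨ x = y i := fun i x hx =>
    hmax _ _ _ _ (hadj (i + 1)) (hadj i).symm hx (hne i)
  obtain rfl : v = y 2 := (hnb 0 v hva.symm).resolve_right ha'v.symm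
  have hund : ∀ j, 4 ≤ j → j < 8 → y j ∉ closedNbhdSet G {y 1, y 2} := by
    intro j h4 h8 hj
    rw [mem_closedNbhdSet_insert, ← insert_empty_eq, mem_closedNbhdSet_insert,
      closedNbhdSet_empty] at hj
    rcases hj with (h | h) | (h | h) | h
    · exact hinj 1 j (by omega) h8 h.symm
    · rcases hnb 0 _ h with h | h
      · exact hinj 2 j (by omega) h8 h.symm
      · exact hinj 0 j (by omega) h8 h.symm
    · exact hinj 2 j (by omega) h8 h.symm
    · rcases hnb 1 _ h with h | h
      · exact hinj 3 j (by omega) h8 h.symm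
      · exact hinj 1 j (by omega) h8 h.symm
    · exact h
  have h4 := hund 4 (by omega) (by omega)
  have h5 := hund 5 (by omega) (by omega)
  have h6 := hund 6 (by omega) (by omega)
  have h7 := hund 7 (by omega) (by omega)
  have h6act : y 6 ∈ activeSet G {y 1, y 2} := mem_activeSet_of_adj (hadj 6) h6 h7
  refine two_mul_isoGameVal_lt (v := y 6) k ?_ h6act
  have hT := ncard_activeSet_insert_add_le (G := G) (X := {y 1, y 2}) (v := y 6)
    (T := {y 4, y 5, y 6, y 7}) (by
      rintro t (rfl | rfl | rfl | rfl)
      · exact mem_activeSet_of_adj (hadj 4) h4 h5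
      · exact mem_activeSet_of_adj (hadj 5) h5 h6
      · exact h6act
      · exact mem_activeSet_of_adj (hadj 6).symm h7 h6) (by
      rintro t (rfl | rfl | rfl | rfl)
      · intro ht
        obtain ⟨z, hz, htz⟩ := exists_adj_mem_activeSet ht
        rcases hnb 3 _ htz with rfl | rfl
        · exact notMem_activeSet_insert (Or.inr (hadj 5).symm) hz
        · have hz' := activeSet_insert_subset hz
          rw [Set.pair_comm] at hz'
          exact notMem_activeSet_insert (Or.inr (hadj 2)) hz'
      · exact notMem_activeSet_insert (Or.inr (hadj 5).symm)
      · exact notMem_activeSet_insert (Or.inl rfl)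
      · exact notMem_activeSet_insert (Or.inr (hadj 6)))
  rwa [Set.ncard_insert_of_notMem (by
      simp [hinj 4 5 (by omega) (by omega), hinj 4 6 (by omega) (by omega),
        hinj 4 7 (by omega) (by omega)]),
    Set.ncard_eq_three.2 ⟨y 5, y 6, y 7, hinj 5 6 (by omega) (by omega),
      hinj 5 7 (by omega) (by omega), hinj 6 7 (by omega) (by omega), rfl⟩] at hT

theorem two_mul_isoGameVal_lt_of_cycle (hG : G.Connected)
    (huniv : activeSet G ∅ = Set.univ)
    (hmax : ∀ v a b c, G.Adj v a → G.Adj v b → G.Adj v c → a ≠ b → c = a ∨ c = b)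
    (hmin : ∀ v u, G.Adj v u → ∃ w, w ≠ u ∧ G.Adj v w)
    (hcard : 8 ≤ Fintype.card V) {v : V} (hv3 : (activeSet G {v}).ncard + 3 ≤ Fintype.card V)
    (k : ℕ) : 2 * isoGameVal G k true ∅ < Fintype.card V := by
  obtain _ | k := k
  · rw [isoGameVal]
    omega
  have h1 := isoGameVal_dominator_le (G := G) (X := ∅) (k := k) (v := v)
    (isPlayable_of_mem_activeSet (by simp [huniv]))
  rw [insert_empty_eq] at h1
  obtain _ | k := k
  · rw [isoGameVal] at h1
    omega
  suffices isoGameVal G (k + 1) false {v} ≤ (Fintype.card V - 3) / 2 by omega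
  refine isoGameVal_staller_le fun s hs => ?_
  have hs1 := ncard_activeSet_insert_add_one_le hs
  by_cases hsv : G.Adj v s
  · have := two_mul_isoGameVal_adj_lt hG hmax hmin hcard hsv k
    omega
  have hsne : s ≠ v := by
    rintro rfl
    obtain ⟨u, hu, hus⟩ := isPlayable_iff.1 hs
    rw [← insert_empty_eq] at hu
    exact notMem_activeSet_insert hus hu
  have hsund : s ∉ closedNbhdSet G {v} := by
    rw [← insert_empty_eq, mem_closedNbhdSet_insert, closedNbhdSet_empty]
    simp [hsv, hsne]
  obtain ⟨u, hu, hsu⟩ : ∃ u ∈ activeSet G {v}, G.Adj s u := by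
    obtain ⟨u, hu, rfl | hsu⟩ := isPlayable_iff.1 hs
    · exact exists_adj_mem_activeSet hu
    · exact ⟨u, hu, hsu⟩
  have hT := ncard_activeSet_insert_add_le (G := G) (X := {v}) (v := s) (T := {s, u})
    (Set.insert_subset (mem_activeSet_of_adj hsu hsund hu.1) (Set.singleton_subset_iff.2 hu))
    (by rintro t (rfl | rfl) <;> apply notMem_activeSet_insert <;> simp [*])
  rw [Set.ncard_pair hsu.ne] at hT
  have := (two_mul_isoGameVal_le (G := G) k {s, v}).1
  omega

theorem nonempty_iso_of_two_mul_iotaGame_eq (hG : G.Connected)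
    (h : 2 * iotaGame G = Fintype.card V) :
    Nonempty (G ≃g completeGraph (Fin 2)) ∨ Nonempty (G ≃g cycleGraph 6) := by
  have hpos : 0 < Fintype.card V := Fintype.card_pos_iff.2 hG.nonempty
  have hnt : Nontrivial V := Fintype.one_lt_card_iff_nontrivial.1 (by omega)
  have hexists : ∀ v, ∃ w, G.Adj v w := fun v => hG.preconnected.exists_adj_of_nontrivial v
  have huniv : activeSet G ∅ = Set.univ := activeSet_empty hexists
  have hcardA : (activeSet G ∅).ncard = Fintype.card V := by
    rw [huniv, Set.ncard_univ, Nat.card_eq_fintype_card]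
  by_cases h2 : Fintype.card V = 2
  · left
    have hcomplete : G = completeGraph V := by
      ext a b
      refine ⟨fun hab => hab.ne, fun hab => ?_⟩
      obtain ⟨w, hw⟩ := hexists a
      by_contra hab'
      have hwb : w ≠ b := by
        rintro rfl
        exact hab' hw
      have : Fintype.card (Fin 3) ≤ Fintype.card V :=
        Fintype.card_le_of_injective ![a, b, w] (by
          intro i j hij
          have hne : a ≠ b := hab
          fin_cases i <;> fin_cases j <;> simp_all [hw.ne, hw.ne.symm, hne.symm, hwb.symm])
      simp at this
      omega
    rw [hcomplete]
    exact ⟨Iso.completeGraph (Fintype.equivFinOfCardEq h2)⟩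
  right
  have h4 : 4 ≤ Fintype.card V := by omega
  have hno : ∀ v, Fintype.card V < (activeSet G {v}).ncard + 4 := by
    intro v
    by_contra! hv
    have := two_mul_isoGameVal_lt (G := G) (X := ∅) (v := v) (Fintype.card V)
      (by rwa [insert_empty_eq, hcardA]) (by simp [huniv])
    rw [hcardA, ← iotaGame] at this
    omega
  have hmax := adj_eq_or_eq_of_forall_lt huniv hno
  have hmin := exists_ne_adj_of_forall_lt hG h4 huniv hno
  obtain ⟨v⟩ := hG.nonempty
  obtain ⟨a, hva⟩ := hexists v
  obtain ⟨b, hba, hvb⟩ := hmin v a hva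
  have hv3 : (activeSet G {v}).ncard + 3 ≤ Fintype.card V := by
    have hT := ncard_activeSet_insert_add_le (G := G) (X := ∅) (v := v) (T := {v, a, b})
      (huniv ▸ Set.subset_univ _)
      (by rintro t (rfl | rfl | rfl) <;> apply notMem_activeSet_insert <;> simp [*])
    rwa [Set.ncard_eq_three.2 ⟨v, a, b, hva.ne, hvb.ne, hba.symm, rfl⟩, hcardA,
      insert_empty_eq] at hT
  by_cases h4' : Fintype.card V = 4
  · exfalso
    have hv4 := hno v
    obtain ⟨x, hx⟩ := Set.ncard_eq_one.1 (show (activeSet G {v}).ncard = 1 by omega)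
    obtain ⟨w, hw, hxw⟩ := exists_adj_mem_activeSet (hx ▸ Set.mem_singleton x : x ∈ activeSet G {v})
    rw [hx] at hw
    exact hxw.ne hw.symm
  by_cases h6 : Fintype.card V = 6
  · obtain ⟨y, -, -, hadj, hne⟩ := exists_nonbacktracking hmin hva
    exact nonempty_iso_cycleGraph_six hG hmax hadj hne h6
  · have := two_mul_isoGameVal_lt_of_cycle hG huniv hmax hmin (by omega) hv3 (Fintype.card V)
    rw [← iotaGame] at this
    omega

end Extremal

theorem iotaGame_completeGraph_two : iotaGame (completeGraph (Fin 2)) = 1 := by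
  have hle := (two_mul_isoGameVal_le (G := completeGraph (Fin 2)) 2 ∅).1
  have hcard := Set.ncard_le_card (activeSet (completeGraph (Fin 2)) ∅)
  have hge : 1 ≤ isoGameVal (completeGraph (Fin 2)) 2 true ∅ :=
    le_isoGameVal_dominator ⟨0, 0, Or.inl rfl, by simp [closedNbhdSet_empty], 1, by simp,
      by simp [closedNbhdSet_empty]⟩ fun _ _ => Nat.le_add_left _ _
  rw [Nat.card_eq_fintype_card, Fintype.card_fin] at hcard
  rw [iotaGame, Fintype.card_fin]
  omega

theorem iotaGame_cycleGraph_six : iotaGame (cycleGraph 6) = 3 := by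
  have hle := (two_mul_isoGameVal_le (G := cycleGraph 6) 6 ∅).1
  have hcard := Set.ncard_le_card (activeSet (cycleGraph 6) ∅)
  have hplay0 : IsPlayable (cycleGraph 6) ∅ 0 := by
    refine ⟨0, Or.inl rfl, by simp [closedNbhdSet_empty], 1, by decide,
      by simp [closedNbhdSet_empty]⟩
  have hplay1 : ∀ v : Fin 6, IsPlayable (cycleGraph 6) {v} (v + 1) := by
    simp only [IsPlayable, closedNbhdSet, Set.mem_ofPred_eq, Set.mem_singleton_iff,
      exists_eq_left]
    decide
  have hplay2 : ∀ v : Fin 6, IsPlayable (cycleGraph 6) {v + 1, v} (v + 4) := by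
    simp only [IsPlayable, closedNbhdSet, Set.mem_ofPred_eq, Set.mem_insert_iff,
      Set.mem_singleton_iff, exists_eq_or_imp, exists_eq_left]
    decide
  have hge : 3 ≤ isoGameVal (cycleGraph 6) 6 true ∅ := by
    refine le_isoGameVal_dominator ⟨0, hplay0⟩ fun v _ => ?_
    rw [insert_empty_eq]
    have h1 : _ ≤ isoGameVal (cycleGraph 6) 5 false {v} :=
      le_isoGameVal_staller (k := 4) (hplay1 v)
    have h2 : 1 ≤ isoGameVal (cycleGraph 6) 4 true {v + 1, v} :=
      le_isoGameVal_dominator ⟨_, hplay2 v⟩ fun _ _ => Nat.le_add_left _ _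
    omega
  rw [Nat.card_eq_fintype_card, Fintype.card_fin] at hcard
  rw [iotaGame, Fintype.card_fin]
  omega

/-- Characterization of equality in the `n/2`-bound for the D-game: a connected graph `G`
of order `n` satisfies `ι_g(G) = n/2` if and only if `G` is `K_2` or `C_6`; and indeed
`ι_g(K_2) = 1` and `ι_g(C_6) = 3`, so both graphs attain equality. -/
theorem game_isolation_half_bound_equality :
    (∀ (V : Type) [Fintype V] (G : SimpleGraph V), G.Connected →
        2 * iotaGame G = Fintype.card V →
        Nonempty (G ≃g completeGraph (Fin 2)) ∨
          Nonempty (G ≃g SimpleGraph.cycleGraph 6)) ∧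
    iotaGame (completeGraph (Fin 2)) = 1 ∧
    iotaGame (SimpleGraph.cycleGraph 6) = 3 := by
  exact ⟨fun _ _ _ hG h => nonempty_iso_of_two_mul_iotaGame_eq hG h,
    iotaGame_completeGraph_two, iotaGame_cycleGraph_six⟩
end

section
/- If T is a tree (a connected acyclic finite simple graph) of order n ≥ 3, then 11·ι_g(T) ≤ 5n (that is, ι_g(T) ≤ (5/11)·n). -/
open SimpleGraph

variable {V : Type*}

lemma SimpleGraph.IsAcyclic.exists_mem_subsingleton_neighbors {V : Type*} [Finite V]
    {G : SimpleGraph V} (hG : G.IsAcyclic) (S : Set V) (hS : S.Nonempty) :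
    ∃ p ∈ S, ∀ a ∈ S, ∀ b ∈ S, G.Adj p a → G.Adj p b → a = b := by
  have : Nonempty S := hS.to_subtype
  obtain ⟨u, v, P, hP, hmax⟩ := Walk.exists_isPath_forall_isPath_length_le_length (G.induce S)
  have key : ∀ w : S, (G.induce S).Adj u w → w = P.snd := by
    intro w hw
    by_cases hws : w ∈ P.support
    · exact (hG.induce S).eq_snd_of_adj_start hP hw hws
    · have := hmax _ _ (Walk.cons hw.symm P) (hP.cons hws)
      simp at this
  refine ⟨u, u.2, fun a ha b hb hpa hpb => ?_⟩
  exact congrArg Subtype.val ((key ⟨a, ha⟩ hpa).trans (key ⟨b, hb⟩ hpb).symm)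

namespace IsolationGame

section Combinatorics

open Classical

/-- `u` lies in the closed neighborhood of `v`. -/
def Hits (G : SimpleGraph V) (v u : V) : Prop := u = v ∨ G.Adj v u

/-- The induced subgraph on `W` has no isolated vertex. -/
def IsolateFree (G : SimpleGraph V) (W : Finset V) : Prop :=
  ∀ u ∈ W, ∃ w ∈ W, G.Adj u w

/-- `v` may be selected when `W` is the set of vertices of the nontrivial undominated
components. -/
def Playable (G : SimpleGraph V) (W : Finset V) (v : V) : Prop :=
  ∃ u ∈ W, Hits G v u

/-- The vertices of the nontrivial undominated components after `v` is selected. -/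
noncomputable def residual (G : SimpleGraph V) (W : Finset V) (v : V) : Finset V :=
  W.filter fun u => ¬ Hits G v u ∧ ∃ w ∈ W, G.Adj u w ∧ ¬ Hits G v w

/-- The vertices of `W` that are lost when `v` is selected. -/
noncomputable def captured (G : SimpleGraph V) (W : Finset V) (v : V) : Finset V :=
  W \ residual G W v

/-- The captured vertices that keep a neighbor in the residual set. -/
noncomputable def boundary (G : SimpleGraph V) (W : Finset V) (v : V) : Finset V :=
  (captured G W v).filter fun u => ∃ w ∈ residual G W v, G.Adj u w

/-- The captured vertices without a neighbor in the residual set. -/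
noncomputable def dead (G : SimpleGraph V) (W : Finset V) (v : V) : Finset V :=
  (captured G W v).filter fun u => ¬ ∃ w ∈ residual G W v, G.Adj u w

/-- `{u, w}` is a component of order two of the graph induced on `W`. -/
def IsPair (G : SimpleGraph V) (W : Finset V) (u w : V) : Prop :=
  u ∈ W ∧ w ∈ W ∧ G.Adj u w ∧ (∀ z ∈ W, G.Adj u z → z = w) ∧ ∀ z ∈ W, G.Adj w z → z = u

/-- `A` contains every vertex outside `W` that is adjacent to a component of `W` of order at
least three. -/
def Guards (G : SimpleGraph V) (W A : Finset V) : Prop :=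
  ∀ y ∉ W, ∀ u ∈ W, G.Adj y u → (∀ w, ¬ IsPair G W u w) → y ∈ A

/-- The vertices of the components of order two of `W` that have no neighbor in `A`. -/
noncomputable def exposed (G : SimpleGraph V) (W A : Finset V) : Finset V :=
  W.filter fun u => ∃ w, IsPair G W u w ∧ ∀ a ∈ A, ¬ G.Adj a u ∧ ¬ G.Adj a w

/-- The potential of a position with guarding set `A`, where a move is worth `22`. -/
noncomputable def potential (G : SimpleGraph V) (W A : Finset V) : ℕ :=
  10 * W.card + 6 * A.card + (exposed G W A).card

/-- Every component of `W` is a path of order two or three (a local formulation). -/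
def ShortPaths (G : SimpleGraph V) (W : Finset V) : Prop :=
  (∀ u ∈ W, ∀ a ∈ W, ∀ b ∈ W, ∀ c ∈ W, G.Adj u a → G.Adj u b → G.Adj u c →
    a = b ∨ a = c ∨ b = c) ∧
  ∀ u ∈ W, ∀ w ∈ W, G.Adj u w → (∃ a ∈ W, ∃ b ∈ W, G.Adj w a ∧ G.Adj w b ∧ a ≠ b) →
    ∀ c ∈ W, G.Adj u c → c = w

/-- The potential drops by at least `22` in Dominator's next move and by at least `44` in the
next two moves. -/
def DominatorProgress (G : SimpleGraph V) (W A : Finset V) : Prop :=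
  ∃ v, Playable G W v ∧ 22 ≤ potential G W A ∧
    ∀ x, Playable G (residual G W v) x →
      ∃ B, Guards G (residual G (residual G W v) x) B ∧
        potential G (residual G (residual G W v) x) B + 44 ≤ potential G W A

variable {G : SimpleGraph V} {W A : Finset V} {u v w : V}

lemma mem_residual :
    u ∈ residual G W v ↔ u ∈ W ∧ ¬ Hits G v u ∧ ∃ w ∈ W, G.Adj u w ∧ ¬ Hits G v w := by
  simp [residual]

lemma residual_subset : residual G W v ⊆ W := Finset.filter_subset _ _

lemma not_adj_of_mem_residual (h : u ∈ residual G W v) : ¬ G.Adj v u :=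
  fun hv => (mem_residual.1 h).2.1 (Or.inr hv)

lemma mem_captured : u ∈ captured G W v ↔ u ∈ W ∧ u ∉ residual G W v := by
  simp [captured]

lemma mem_boundary :
    u ∈ boundary G W v ↔ u ∈ captured G W v ∧ ∃ w ∈ residual G W v, G.Adj u w := by
  simp [boundary]

lemma mem_dead :
    u ∈ dead G W v ↔ u ∈ captured G W v ∧ ∀ w ∈ residual G W v, ¬ G.Adj u w := by
  simp [dead]

lemma mem_captured_of_hits (hu : u ∈ W) (h : Hits G v u) : u ∈ captured G W v :=
  mem_captured.2 ⟨hu, fun h' => (mem_residual.1 h').2.1 h⟩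

lemma mem_captured_of_forall_hits (hu : u ∈ W) (h : ∀ w ∈ W, G.Adj u w → Hits G v w) :
    u ∈ captured G W v := by
  refine mem_captured.2 ⟨hu, fun h' => ?_⟩
  obtain ⟨-, -, w, hw, huw, hn⟩ := mem_residual.1 h'
  exact hn (h w hw huw)

lemma hits_of_mem_boundary (h : u ∈ boundary G W v) : Hits G v u := by
  obtain ⟨hc, w, hw, huw⟩ := mem_boundary.1 h
  obtain ⟨hu, hr⟩ := mem_captured.1 hc
  by_contra hn
  exact hr (mem_residual.2 ⟨hu, hn, w, (mem_residual.1 hw).1, huw, (mem_residual.1 hw).2.1⟩)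

lemma card_captured : (captured G W v).card = (boundary G W v).card + (dead G W v).card :=
  (Finset.card_filter_add_card_filter_not _).symm

lemma IsolateFree.residual (_ : IsolateFree G W) : IsolateFree G (residual G W v) := by
  intro u hu
  obtain ⟨huW, hn, w, hw, huw, hwn⟩ := mem_residual.1 hu
  exact ⟨w, mem_residual.2 ⟨hw, hwn, u, huW, huw.symm, hn⟩, huw⟩

lemma ShortPaths.mono {W' : Finset V} (h : ShortPaths G W) (hs : W' ⊆ W) : ShortPaths G W' := by
  refine ⟨fun u hu a ha b hb c hc => h.1 u (hs hu) a (hs ha) b (hs hb) c (hs hc),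
    fun u hu w hw huw hab c hc => h.2 u (hs hu) w (hs hw) huw ?_ c (hs hc)⟩
  obtain ⟨a, ha, b, hb, h'⟩ := hab
  exact ⟨a, hs ha, b, hs hb, h'⟩

lemma IsPair.residual (h : IsPair G W u w) (hu : u ∈ residual G W v) :
    IsPair G (residual G W v) u w := by
  obtain ⟨huW, hn, z, hz, huz, hzn⟩ := mem_residual.1 hu
  obtain ⟨h1, h2, h3, h4, h5⟩ := h
  obtain rfl := h4 z hz huz
  exact ⟨hu, mem_residual.2 ⟨hz, hzn, u, huW, huz.symm, hn⟩, huz,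
    fun y hy => h4 y (residual_subset hy), fun y hy => h5 y (residual_subset hy)⟩

lemma IsPair.mem_dead (h : IsPair G W u w) (hv : Hits G v u) :
    u ∈ dead G W v ∧ w ∈ dead G W v := by
  obtain ⟨h1, h2, h3, h4, h5⟩ := h
  have hu := mem_captured_of_hits h1 hv
  have hw : w ∈ captured G W v :=
    mem_captured_of_forall_hits h2 fun z hz hwz => h5 z hz hwz ▸ hv
  refine ⟨IsolationGame.mem_dead.2 ⟨hu, fun z hz huz => ?_⟩,
    IsolationGame.mem_dead.2 ⟨hw, fun z hz hwz => ?_⟩⟩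
  · exact (mem_captured.1 hw).2 (h4 z (residual_subset hz) huz ▸ hz)
  · exact (mem_captured.1 hu).2 (h5 z (residual_subset hz) hwz ▸ hz)

lemma self_mem_dead (h : v ∈ W) : v ∈ dead G W v :=
  mem_dead.2 ⟨mem_captured_of_hits h (Or.inl rfl), fun _ hz => not_adj_of_mem_residual hz⟩

lemma guards_residual (hA : Guards G W A) :
    Guards G (residual G W v) (A.erase v ∪ boundary G W v) := by
  intro y hy u hu hyu hp
  by_cases hyW : y ∈ W
  · exact Finset.mem_union_right _ (mem_boundary.2 ⟨mem_captured.2 ⟨hyW, hy⟩, u, hu, hyu⟩)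
  · refine Finset.mem_union_left _ (Finset.mem_erase.2 ⟨?_, ?_⟩)
    · rintro rfl
      exact not_adj_of_mem_residual hu hyu
    · exact hA y hyW u (residual_subset hu) hyu fun w hw => hp w (hw.residual hu)

lemma card_residual_add_card_captured :
    (residual G W v).card + (captured G W v).card = W.card := by
  rw [add_comm]
  exact Finset.card_sdiff_add_card_eq_card residual_subset

lemma exposed_residual_subset :
    exposed G (residual G W v) (A.erase v ∪ boundary G W v) ⊆ exposed G W A := by
  intro u hu
  obtain ⟨huR, w, ⟨-, hwR, huw, h4, h5⟩, hx⟩ := Finset.mem_filter.1 hu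
  refine Finset.mem_filter.2 ⟨residual_subset huR, w,
    ⟨residual_subset huR, residual_subset hwR, huw, fun z hz huz => ?_, fun z hz hwz => ?_⟩,
    fun a ha => ?_⟩
  · by_cases hzR : z ∈ residual G W v
    · exact h4 z hzR huz
    · exact absurd huz.symm (hx z (Finset.mem_union_right _
        (mem_boundary.2 ⟨mem_captured.2 ⟨hz, hzR⟩, u, huR, huz.symm⟩))).1
  · by_cases hzR : z ∈ residual G W v
    · exact h5 z hzR hwz
    · exact absurd hwz.symm (hx z (Finset.mem_union_right _
        (mem_boundary.2 ⟨mem_captured.2 ⟨hz, hzR⟩, w, hwR, hwz.symm⟩))).2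
  · by_cases hav : a = v
    · subst hav
      exact ⟨not_adj_of_mem_residual huR, not_adj_of_mem_residual hwR⟩
    · exact hx a (Finset.mem_union_left _ (Finset.mem_erase.2 ⟨hav, ha⟩))

lemma potential_residual_le :
    potential G (residual G W v) (A.erase v ∪ boundary G W v) + 4 * (captured G W v).card +
      6 * (dead G W v).card + 6 * (A.card - (A.erase v).card) ≤ potential G W A := by
  have h1 := Finset.card_le_card (exposed_residual_subset (G := G) (W := W) (A := A) (v := v))
  have h2 := Finset.card_union_le (A.erase v) (boundary G W v)
  have h3 := card_captured (G := G) (W := W) (v := v)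
  have h4 := card_residual_add_card_captured (G := G) (W := W) (v := v)
  have h5 := Finset.card_le_card (Finset.erase_subset v A)
  unfold potential
  omega

lemma exists_guards_residual (hA : Guards G W A) (n : ℕ)
    (hn : n ≤ 4 * (captured G W v).card + 6 * (dead G W v).card +
      6 * (A.card - (A.erase v).card)) :
    ∃ B, Guards G (residual G W v) B ∧ potential G (residual G W v) B + n ≤ potential G W A :=
  ⟨_, guards_residual hA, by
    have := potential_residual_le (G := G) (W := W) (A := A) (v := v)
    omega⟩

lemma dead_subset_captured : dead G W v ⊆ captured G W v := Finset.filter_subset _ _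

lemma two_le_card_captured_of_mem (hW : IsolateFree G W) (hv : v ∈ W) :
    2 ≤ (captured G W v).card := by
  obtain ⟨u, hu, hvu⟩ := hW v hv
  exact Finset.one_lt_card.2 ⟨v, mem_captured_of_hits hv (Or.inl rfl), u,
    mem_captured_of_hits hu (Or.inr hvu), hvu.ne⟩

lemma IsPair.two_le_card_dead (h : IsPair G W u w) (hv : Hits G v u) :
    2 ≤ (dead G W v).card :=
  Finset.one_lt_card.2 ⟨u, (h.mem_dead hv).1, w, (h.mem_dead hv).2, h.2.2.1.ne⟩

lemma card_erase_of_mem' (h : v ∈ A) : A.card - (A.erase v).card = 1 := by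
  have := Finset.card_pos.2 ⟨v, h⟩
  rw [Finset.card_erase_of_mem h]
  omega

/-- Every move lowers the potential by at least `10`. -/
lemma exists_guards_residual_ten (hW : IsolateFree G W) (hA : Guards G W A)
    (hv : Playable G W v) :
    ∃ B, Guards G (residual G W v) B ∧
      potential G (residual G W v) B + 10 ≤ potential G W A := by
  apply exists_guards_residual hA
  by_cases hvW : v ∈ W
  · have := two_le_card_captured_of_mem hW hvW
    have := Finset.card_pos.2 ⟨v, self_mem_dead (G := G) hvW⟩
    omega
  obtain ⟨u, hu, hvu⟩ := hv
  by_cases hp : ∃ w, IsPair G W u w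
  · obtain ⟨w, hp⟩ := hp
    have := hp.two_le_card_dead hvu
    omega
  · have hadj : G.Adj v u := hvu.resolve_left fun h => hvW (h ▸ hu)
    have := card_erase_of_mem' (hA v hvW u hu hadj (not_exists.1 hp))
    have := Finset.card_pos.2 ⟨u, mem_captured_of_hits hu hvu⟩
    omega

/-- Every move lowers the potential by at least `14` when all components are short paths. -/
lemma ShortPaths.exists_guards_residual (hs : ShortPaths G W) (hW : IsolateFree G W)
    (hA : Guards G W A) (hv : Playable G W v) :
    ∃ B, Guards G (residual G W v) B ∧
      potential G (residual G W v) B + 14 ≤ potential G W A := by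
  by_cases hvW : v ∈ W
  · apply IsolationGame.exists_guards_residual hA
    have := two_le_card_captured_of_mem hW hvW
    have := Finset.card_pos.2 ⟨v, self_mem_dead (G := G) hvW⟩
    omega
  obtain ⟨u, hu, hvu⟩ := hv
  have hadj : G.Adj v u := hvu.resolve_left fun h => hvW (h ▸ hu)
  by_cases hp : ∃ w, IsPair G W u w
  · apply IsolationGame.exists_guards_residual hA
    obtain ⟨w, hp⟩ := hp
    have := hp.two_le_card_dead hvu
    have := Finset.card_le_card (dead_subset_captured (G := G) (W := W) (v := v))
    omega
  have hvA := card_erase_of_mem' (hA v hvW u hu hadj (not_exists.1 hp))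
  have huc := mem_captured_of_hits hu hvu
  by_cases hc : 2 ≤ (captured G W v).card
  · exact IsolationGame.exists_guards_residual hA _ (by omega)
  have hcu : ∀ x ∈ captured G W v, x = u := fun x hx => by
    by_contra hne
    exact hc (Finset.one_lt_card.2 ⟨x, hx, u, huc, hne⟩)
  by_cases hd : u ∈ dead G W v
  · apply IsolationGame.exists_guards_residual hA
    have := Finset.card_pos.2 ⟨u, hd⟩
    have := Finset.card_pos.2 ⟨u, huc⟩
    omega
  obtain ⟨m, hmR, hum⟩ : ∃ m ∈ residual G W v, G.Adj u m := by
    by_contra! h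
    exact hd (mem_dead.2 ⟨huc, h⟩)
  have hm := residual_subset hmR
  have hum' : ∀ z ∈ W, G.Adj u z → z = m := by
    intro z hz huz
    by_contra hne
    have hzu := hs.2 z hz u hu huz.symm ⟨z, hz, m, hm, huz, hum, hne⟩
    exact huz.ne (hcu z (mem_captured_of_forall_hits hz fun y hy hzy => hzu y hy hzy ▸ hvu)).symm
  obtain ⟨l, hl, hml, hlu⟩ : ∃ l ∈ W, G.Adj m l ∧ l ≠ u := by
    by_contra! h
    exact hp ⟨m, hu, hm, hum, hum', h⟩
  have hlm := hs.2 l hl m hm hml.symm ⟨l, hl, u, hu, hml, hum.symm, hlu⟩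
  have hlR : l ∈ residual G W v := by
    by_contra h
    exact hlu (hcu l (mem_captured.2 ⟨hl, h⟩))
  have huR := (mem_captured.1 huc).2
  have hmn : ∀ z ∈ W, G.Adj m z → z = u ∨ z = l := by
    intro z hz hmz
    rcases hs.1 m hm u hu l hl z hz hum.symm hml hmz with h | h | h
    · exact absurd h.symm hlu
    · exact Or.inl h.symm
    · exact Or.inr h.symm
  have hml' : IsPair G (residual G W v) m l :=
    ⟨hmR, hlR, hml, fun z hz hmz => (hmn z (residual_subset hz) hmz).resolve_left
      fun h => huR (h ▸ hz), fun z hz => hlm z (residual_subset hz)⟩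
  have hsub : exposed G (residual G W v) (A.erase v) ⊆ exposed G W A ∪ {m, l} := by
    intro x hx
    obtain ⟨hxR, w, ⟨-, hwR, hxw, h4, h5⟩, hxA⟩ := Finset.mem_filter.1 hx
    by_cases hxm : x = m
    · simp [hxm]
    by_cases hwm : w = m
    · subst hwm
      simp [hml'.2.2.2.1 x hxR hxw.symm]
    refine Finset.mem_union_left _ (Finset.mem_filter.2 ⟨residual_subset hxR, w,
      ⟨residual_subset hxR, residual_subset hwR, hxw, fun z hz hxz => ?_, fun z hz hwz => ?_⟩,
      fun a ha => ?_⟩)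
    · refine h4 z ?_ hxz
      by_contra hzR
      rw [hcu z (mem_captured.2 ⟨hz, hzR⟩)] at hxz
      exact hxm (hum' x (residual_subset hxR) hxz.symm)
    · refine h5 z ?_ hwz
      by_contra hzR
      rw [hcu z (mem_captured.2 ⟨hz, hzR⟩)] at hwz
      exact hwm (hum' w (residual_subset hwR) hwz.symm)
    · by_cases hav : a = v
      · subst hav
        exact ⟨not_adj_of_mem_residual hxR, not_adj_of_mem_residual hwR⟩
      · exact hxA a (Finset.mem_erase.2 ⟨hav, ha⟩)
  refine ⟨A.erase v, fun y hy x hx hyx hxp => ?_, ?_⟩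
  · by_cases hyW : y ∈ W
    · obtain rfl := hcu y (mem_captured.2 ⟨hyW, hy⟩)
      obtain rfl := hum' x (residual_subset hx) hyx
      exact absurd hml' (hxp l)
    · refine Finset.mem_erase.2 ⟨?_, hA y hyW x (residual_subset hx) hyx
        fun w hw => hxp w (hw.residual hx)⟩
      rintro rfl
      exact not_adj_of_mem_residual hx hyx
  · have h1 := (Finset.card_le_card hsub).trans (Finset.card_union_le _ _)
    have h2 : ({m, l} : Finset V).card ≤ 2 := Finset.card_le_two
    have h3 := card_residual_add_card_captured (G := G) (W := W) (v := v)
    have h4 := Finset.card_pos.2 ⟨u, huc⟩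
    unfold potential
    omega

lemma dominatorProgress_of_large_gain (hW : IsolateFree G W) (hA : Guards G W A)
    (hv : Playable G W v) (h : 34 ≤ 4 * (captured G W v).card + 6 * (dead G W v).card) :
    DominatorProgress G W A := by
  obtain ⟨B, hB, hpot⟩ := exists_guards_residual (v := v) hA 34 (by omega)
  refine ⟨v, hv, by omega, fun x hx => ?_⟩
  obtain ⟨C, hC, hC'⟩ := exists_guards_residual_ten hW.residual hB hx
  exact ⟨C, hC, by omega⟩

lemma ShortPaths.dominatorProgress_of_gain (hs : ShortPaths G W) (hW : IsolateFree G W)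
    (hA : Guards G W A) (hv : Playable G W v) (h : 3 ≤ (dead G W v).card) :
    DominatorProgress G W A := by
  have := Finset.card_le_card (dead_subset_captured (G := G) (W := W) (v := v))
  obtain ⟨B, hB, hpot⟩ := IsolationGame.exists_guards_residual (v := v) hA 30 (by omega)
  refine ⟨v, hv, by omega, fun x hx => ?_⟩
  obtain ⟨C, hC, hC'⟩ :=
    (hs.mono residual_subset).exists_guards_residual hW.residual hB hx
  exact ⟨C, hC, by omega⟩

/-- If two vertices of degree at least two in `W` are adjacent, Dominator has a move that
captures at least four vertices with at most one of them on the boundary. -/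
lemma dominatorProgress_of_adj_nonleaf [Finite V] (hG : G.IsAcyclic) (hW : IsolateFree G W)
    (hA : Guards G W A)
    (h : ∃ u ∈ W, ∃ w ∈ W, G.Adj u w ∧ (∃ a ∈ W, G.Adj u a ∧ a ≠ w) ∧
      ∃ b ∈ W, G.Adj w b ∧ b ≠ u) :
    DominatorProgress G W A := by
  let N : V → Prop := fun x => ∃ a ∈ W, ∃ b ∈ W, G.Adj x a ∧ G.Adj x b ∧ a ≠ b
  let S : Set V := {x | x ∈ W ∧ ∃ a ∈ W, ∃ b ∈ W, G.Adj x a ∧ G.Adj x b ∧ a ≠ b ∧ N a ∧ N b}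
  obtain ⟨p, hpW, hpN, ⟨s, hsW, hps, hsN, hsS⟩, hpS⟩ : ∃ p ∈ W, N p ∧
      (∃ s ∈ W, G.Adj p s ∧ N s ∧ s ∉ S) ∧
      ∀ a ∈ S, ∀ b ∈ S, G.Adj p a → G.Adj p b → a = b := by
    by_cases hS : S.Nonempty
    · obtain ⟨p, ⟨hpW, a, ha, b, hb, hpa, hpb, hab, haN, hbN⟩, hpS⟩ :=
        hG.exists_mem_subsingleton_neighbors S hS
      refine ⟨p, hpW, ⟨a, ha, b, hb, hpa, hpb, hab⟩, ?_, hpS⟩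
      by_cases haS : a ∈ S
      · exact ⟨b, hb, hpb, hbN, fun hbS => hab (hpS a haS b hbS hpa hpb)⟩
      · exact ⟨a, ha, hpa, haN, haS⟩
    · rw [Set.not_nonempty_iff_eq_empty] at hS
      obtain ⟨u, hu, w, hw, huw, ⟨a, ha, hua, haw⟩, b, hb, hwb, hbu⟩ := h
      exact ⟨u, hu, ⟨a, ha, w, hw, hua, huw, haw⟩,
        ⟨w, hw, huw, ⟨b, hb, u, hu, hwb, huw.symm, hbu⟩, by simp [hS]⟩, by simp [hS]⟩
  have leaf : ∀ x ∈ W, x ∉ S → G.Adj p x → ∀ y ∈ W, G.Adj x y → y ≠ p →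
      ∀ z ∈ W, G.Adj y z → z = x := by
    intro x hx hxS hpx y hy hxy hyp z hz hyz
    by_contra hzx
    exact hxS ⟨hx, y, hy, p, hpW, hxy, hpx.symm, hyp,
      ⟨z, hz, x, hx, hyz, hxy.symm, hzx⟩, hpN⟩
  have hb : (boundary G W p).card ≤ 1 := by
    have hbS : ∀ x ∈ boundary G W p, x ∈ S ∧ G.Adj p x := by
      intro x hx
      obtain ⟨hxc, y, hy, hxy⟩ := mem_boundary.1 hx
      have hpx : G.Adj p x := by
        refine (hits_of_mem_boundary hx).resolve_left ?_
        rintro rfl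
        exact not_adj_of_mem_residual hy hxy
      refine ⟨?_, hpx⟩
      by_contra hxS
      have hyl := leaf x (mem_captured.1 hxc).1 hxS hpx y (residual_subset hy) hxy fun hyp =>
        (mem_residual.1 hy).2.1 (Or.inl hyp)
      obtain ⟨-, -, z, hz, hyz, hzn⟩ := mem_residual.1 hy
      exact hzn (Or.inr (hyl z hz hyz ▸ hpx))
    refine Finset.card_le_one.2 fun a ha b hb => ?_
    exact hpS a (hbS a ha).1 b (hbS b hb).1 (hbS a ha).2 (hbS b hb).2
  obtain ⟨l, hl, hsl, hlp⟩ : ∃ l ∈ W, G.Adj s l ∧ l ≠ p := by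
    obtain ⟨a, ha, b, hb, hsa, hsb, hab⟩ := hsN
    by_cases hap : a = p
    · exact ⟨b, hb, hsb, fun hbp => hab (hap.trans hbp.symm)⟩
    · exact ⟨a, ha, hsa, hap⟩
  obtain ⟨q, hq, hpq, hqs⟩ : ∃ q ∈ W, G.Adj p q ∧ q ≠ s := by
    obtain ⟨a, ha, b, hb, hpa, hpb, hab⟩ := hpN
    by_cases has : a = s
    · exact ⟨b, hb, hpb, fun hbs => hab (has.trans hbs.symm)⟩
    · exact ⟨a, ha, hpa, has⟩
  have hll := leaf s hsW hsS hps l hl hsl hlp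
  have hlq : l ≠ q := by
    rintro rfl
    exact hps.ne (hll p hpW hpq.symm)
  have hc : 4 ≤ (captured G W p).card := by
    have hsub : ({p, s, q, l} : Finset V) ⊆ captured G W p := by
      intro x hx
      simp only [Finset.mem_insert, Finset.mem_singleton] at hx
      rcases hx with rfl | rfl | rfl | rfl
      · exact mem_captured_of_hits hpW (Or.inl rfl)
      · exact mem_captured_of_hits hsW (Or.inr hps)
      · exact mem_captured_of_hits hq (Or.inr hpq)
      · exact mem_captured_of_forall_hits hl fun z hz hlz => Or.inr (hll z hz hlz ▸ hps)
    have := Finset.card_le_card hsub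
    rwa [Finset.card_insert_of_notMem, Finset.card_insert_of_notMem,
      Finset.card_insert_of_notMem, Finset.card_singleton] at this
    · simpa using hlq.symm
    · simp [hqs.symm, hsl.ne]
    · simp [hps.ne, hpq.ne, hlp.symm]
  refine dominatorProgress_of_large_gain hW hA ⟨p, hpW, Or.inl rfl⟩ ?_
  have := card_captured (G := G) (W := W) (v := p)
  omega

lemma boundary_eq_empty_of_leaves (h : ∀ x ∈ W, G.Adj v x → ∀ y ∈ W, G.Adj x y → y = v) :
    boundary G W v = ∅ := by
  refine Finset.eq_empty_of_forall_notMem fun x hx => ?_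
  obtain ⟨hxc, y, hy, hxy⟩ := mem_boundary.1 hx
  rcases hits_of_mem_boundary hx with rfl | hvx
  · exact not_adj_of_mem_residual hy hxy
  · exact (mem_residual.1 hy).2.1
      (Or.inl (h x (mem_captured.1 hxc).1 hvx y (residual_subset hy) hxy))

lemma exists_isPair (hW : IsolateFree G W)
    (hl : ∀ u ∈ W, ∀ a ∈ W, ∀ b ∈ W, G.Adj u a → G.Adj u b → a = b) (hu : u ∈ W) :
    ∃ w, IsPair G W u w := by
  obtain ⟨w, hw, huw⟩ := hW u hu
  exact ⟨w, hu, hw, huw, fun z hz huz => hl u hu z hz w hw huz huw,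
    fun z hz hwz => hl w hw z hz u hu hwz huw.symm⟩

lemma potential_empty (hW : IsolateFree G W)
    (hl : ∀ u ∈ W, ∀ a ∈ W, ∀ b ∈ W, G.Adj u a → G.Adj u b → a = b) :
    potential G W ∅ = 11 * W.card := by
  have : exposed G W ∅ = W := by
    refine Finset.filter_true_of_mem fun u hu => ?_
    obtain ⟨w, hw⟩ := exists_isPair hW hl hu
    exact ⟨w, hw, by simp⟩
  simp only [potential, this, Finset.card_empty]
  omega

/-- Dominator's progress when all components have order two. -/
lemma dominatorProgress_of_matching (hW : IsolateFree G W) (hne : W.Nonempty)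
    (hl : ∀ u ∈ W, ∀ a ∈ W, ∀ b ∈ W, G.Adj u a → G.Adj u b → a = b) (A : Finset V) :
    DominatorProgress G W A := by
  have hs : ShortPaths G W := by
    refine ⟨fun u hu a ha b hb c _ hua hub _ => Or.inl (hl u hu a ha b hb hua hub), ?_⟩
    rintro u - w hw - ⟨a, ha, b, hb, hwa, hwb, hab⟩
    exact absurd (hl w hw a ha b hb hwa hwb) hab
  have hguard : ∀ B, Guards G W B := fun B y _ u hu _ hp => by
    obtain ⟨w, hw⟩ := exists_isPair hW hl hu
    exact absurd hw (hp w)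
  induction A using Finset.induction_on with
  | empty =>
    have two : ∀ {W : Finset V} {v : V}, IsolateFree G W →
        (∀ u ∈ W, ∀ a ∈ W, ∀ b ∈ W, G.Adj u a → G.Adj u b → a = b) → Playable G W v →
        (residual G W v).card + 2 ≤ W.card := by
      rintro W v hW hl ⟨u, hu, hvu⟩
      obtain ⟨w, hw⟩ := exists_isPair hW hl hu
      have h1 := hw.two_le_card_dead hvu
      have h2 := Finset.card_le_card (dead_subset_captured (G := G) (W := W) (v := v))
      have h3 := card_residual_add_card_captured (G := G) (W := W) (v := v)
      omega
    obtain ⟨v, hv⟩ := hne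
    have hl' : ∀ {W' : Finset V}, W' ⊆ W →
        ∀ u ∈ W', ∀ a ∈ W', ∀ b ∈ W', G.Adj u a → G.Adj u b → a = b :=
      fun h u hu a ha b hb => hl u (h hu) a (h ha) b (h hb)
    have hp : Playable G W v := ⟨v, hv, Or.inl rfl⟩
    have h1 := two hW hl hp
    have h0 := potential_empty hW hl
    refine ⟨v, hp, by omega, fun x hx => ⟨∅, ?_, ?_⟩⟩
    · intro y _ u hu _ hp
      obtain ⟨w, hw⟩ := exists_isPair hW.residual.residual
        (hl' (residual_subset.trans residual_subset)) hu
      exact absurd hw (hp w)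
    · have h2 := two hW.residual (hl' residual_subset) hx
      rw [potential_empty hW.residual.residual
        (hl' (residual_subset.trans residual_subset)), h0]
      omega
  | insert x A hxA ih =>
    by_cases hthree : ∃ u w, IsPair G W u w ∧ G.Adj x u ∧
        ∃ z ∈ W, G.Adj x z ∧ z ≠ u ∧ z ≠ w
    · obtain ⟨u, w, huw, hxu, z, hz, hxz, hzu, hzw⟩ := hthree
      obtain ⟨z', hzz'⟩ := exists_isPair hW hl hz
      refine hs.dominatorProgress_of_gain hW (hguard _) ⟨u, huw.1, Or.inr hxu⟩ ?_
      obtain ⟨hu, hw⟩ := huw.mem_dead (v := x) (Or.inr hxu)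
      exact Finset.two_lt_card.2 ⟨u, hu, w, hw, z, (hzz'.mem_dead (Or.inr hxz)).1,
        huw.2.2.1.ne, hzu.symm, hzw.symm⟩
    · push Not at hthree
      have hle : potential G W A ≤ potential G W (insert x A) := by
        have hsub : exposed G W A ⊆ exposed G W (insert x A) ∪
            (W.filter fun y => ∃ z, IsPair G W y z ∧ (G.Adj x y ∨ G.Adj x z)) := by
          intro y hy
          obtain ⟨hyW, z, hyz, hA⟩ := Finset.mem_filter.1 hy
          by_cases hxyz : G.Adj x y ∨ G.Adj x z
          · exact Finset.mem_union_right _ (Finset.mem_filter.2 ⟨hyW, z, hyz, hxyz⟩)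
          · push Not at hxyz
            refine Finset.mem_union_left _ (Finset.mem_filter.2 ⟨hyW, z, hyz, ?_⟩)
            intro a ha
            rcases Finset.mem_insert.1 ha with rfl | ha
            · exact hxyz
            · exact hA a ha
        have hcard : (W.filter fun y => ∃ z, IsPair G W y z ∧ (G.Adj x y ∨ G.Adj x z)).card
            ≤ 4 := by
          by_cases hex : ∃ u ∈ W, G.Adj x u
          · obtain ⟨u, hu, hxu⟩ := hex
            obtain ⟨w, hw⟩ := exists_isPair hW hl hu
            have : (W.filter fun y => ∃ z, IsPair G W y z ∧ (G.Adj x y ∨ G.Adj x z)) ⊆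
                {u, w} := by
              intro y hy
              obtain ⟨hyW, z, hyz, hxyz⟩ := Finset.mem_filter.1 hy
              have h := fun t ht htx => or_iff_not_imp_left.2 (hthree u w hw hxu t ht htx)
              simp only [Finset.mem_insert, Finset.mem_singleton]
              rcases hxyz with hxy | hxz
              · exact h y hyW hxy
              · rcases h z hyz.2.1 hxz with rfl | rfl
                · exact Or.inr (hw.2.2.2.1 y hyW hyz.2.2.1.symm)
                · exact Or.inl (hw.2.2.2.2 y hyW hyz.2.2.1.symm)
            exact ((Finset.card_le_card this).trans Finset.card_le_two).trans (by norm_num)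
          · push Not at hex
            rw [Finset.filter_false_of_mem]
            · simp
            · rintro y hy ⟨z, hyz, hxy | hxz⟩
              · exact hex y hy hxy
              · exact hex z hyz.2.1 hxz
        have h1 := (Finset.card_le_card hsub).trans (Finset.card_union_le _ _)
        have h2 := Finset.card_insert_of_notMem hxA
        unfold potential
        omega
      obtain ⟨v, hv, h22, h44⟩ := ih
      refine ⟨v, hv, by omega, fun y hy => ?_⟩
      obtain ⟨B, hB, hB'⟩ := h44 y hy
      exact ⟨B, hB, by omega⟩

theorem dominatorProgress [Finite V] (hG : G.IsAcyclic) (hW : IsolateFree G W)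
    (hne : W.Nonempty) (hA : Guards G W A) : DominatorProgress G W A := by
  by_cases h : ∃ u ∈ W, ∃ w ∈ W, G.Adj u w ∧ (∃ a ∈ W, G.Adj u a ∧ a ≠ w) ∧
      ∃ b ∈ W, G.Adj w b ∧ b ≠ u
  · exact dominatorProgress_of_adj_nonleaf hG hW hA h
  have leaf : ∀ v ∈ W, (∃ a ∈ W, ∃ b ∈ W, G.Adj v a ∧ G.Adj v b ∧ a ≠ b) →
      ∀ x ∈ W, G.Adj v x → ∀ y ∈ W, G.Adj x y → y = v := by
    rintro v hv ⟨a, ha, b, hb, hva, hvb, hab⟩ x hx hvx y hy hxy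
    by_contra hyv
    refine h ⟨x, hx, v, hv, hvx.symm, ⟨y, hy, hxy, hyv⟩, ?_⟩
    by_cases hax : a = x
    · exact ⟨b, hb, hvb, fun hbx => hab (hax.trans hbx.symm)⟩
    · exact ⟨a, ha, hva, hax⟩
  by_cases h3 : ∃ v ∈ W, ∃ a ∈ W, ∃ b ∈ W, ∃ c ∈ W,
      G.Adj v a ∧ G.Adj v b ∧ G.Adj v c ∧ a ≠ b ∧ a ≠ c ∧ b ≠ c
  · obtain ⟨v, hv, a, ha, b, hb, c, hc, hva, hvb, hvc, hab, hac, hbc⟩ := h3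
    have h0 := boundary_eq_empty_of_leaves (leaf v hv ⟨a, ha, b, hb, hva, hvb, hab⟩)
    have hcard := card_captured (G := G) (W := W) (v := v)
    rw [h0, Finset.card_empty] at hcard
    have hsub : ({v, a, b, c} : Finset V) ⊆ captured G W v := by
      intro x hx
      simp only [Finset.mem_insert, Finset.mem_singleton] at hx
      rcases hx with rfl | rfl | rfl | rfl
      · exact mem_captured_of_hits hv (Or.inl rfl)
      · exact mem_captured_of_hits ha (Or.inr hva)
      · exact mem_captured_of_hits hb (Or.inr hvb)
      · exact mem_captured_of_hits hc (Or.inr hvc)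
    have hfour := Finset.card_le_card hsub
    rw [Finset.card_insert_of_notMem (by simp [hva.ne, hvb.ne, hvc.ne]),
      Finset.card_insert_of_notMem (by simp [hab, hac]),
      Finset.card_insert_of_notMem (by simpa using hbc), Finset.card_singleton] at hfour
    exact dominatorProgress_of_large_gain hW hA ⟨v, hv, Or.inl rfl⟩ (by omega)
  have hs : ShortPaths G W := by
    refine ⟨fun u hu a ha b hb c hc hua hub huc => ?_, fun u hu w hw huw hab c hc huc =>
      leaf w hw hab u hu huw.symm c hc huc⟩
    by_contra! hne
    exact h3 ⟨u, hu, a, ha, b, hb, c, hc, hua, hub, huc, hne⟩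
  by_cases h2 : ∃ v ∈ W, ∃ a ∈ W, ∃ b ∈ W, G.Adj v a ∧ G.Adj v b ∧ a ≠ b
  · obtain ⟨v, hv, a, ha, b, hb, hva, hvb, hab⟩ := h2
    have h0 := boundary_eq_empty_of_leaves (leaf v hv ⟨a, ha, b, hb, hva, hvb, hab⟩)
    have hcard := card_captured (G := G) (W := W) (v := v)
    rw [h0, Finset.card_empty, zero_add] at hcard
    refine hs.dominatorProgress_of_gain hW hA ⟨v, hv, Or.inl rfl⟩ ?_
    rw [← hcard]
    exact Finset.two_lt_card.2 ⟨v, mem_captured_of_hits hv (Or.inl rfl),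
      a, mem_captured_of_hits ha (Or.inr hva), b, mem_captured_of_hits hb (Or.inr hvb),
      hva.ne, hvb.ne, hab⟩
  · refine dominatorProgress_of_matching hW hne (fun u hu a ha b hb hua hub => ?_) A
    by_contra hab
    exact h2 ⟨u, hu, a, ha, b, hb, hua, hub, hab⟩

end Combinatorics

section Game

open Classical

variable {G : SimpleGraph V} {X : Set V} {v : V}

lemma notMem_closedNbhdSet_insert {u : V} :
    u ∉ closedNbhdSet G (insert v X) ↔ u ∉ closedNbhdSet G X ∧ ¬ Hits G v u := by
  simp only [closedNbhdSet, Hits, Set.mem_ofPred_eq, Set.mem_insert_iff, exists_eq_or_imp]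
  rw [← not_or, or_or_or_comm, or_comm]

lemma isoGameVal_dominator_le (k : ℕ) (hv : IsPlayable G X v) :
    isoGameVal G (k + 1) true X ≤ isoGameVal G k false (insert v X) + 1 := by
  rw [isoGameVal, if_pos ⟨v, hv⟩]
  exact Nat.sInf_le ⟨v, hv, rfl⟩

lemma isoGameVal_staller_le (k n : ℕ)
    (h : ∀ v, IsPlayable G X v → isoGameVal G k true (insert v X) + 1 ≤ n) :
    isoGameVal G (k + 1) false X ≤ n := by
  rw [isoGameVal]
  by_cases hp : ∃ v, IsPlayable G X v
  · rw [if_pos hp]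
    simp only [Bool.false_eq_true, if_false]
    refine csSup_le' ?_
    rintro _ ⟨v, hv, rfl⟩
    exact h v hv
  · rw [if_neg hp]
    exact Nat.zero_le n

variable [Fintype V]

/-- The vertices of the nontrivial components of `G - N_G[X]`. -/
noncomputable def active (G : SimpleGraph V) (X : Set V) : Finset V :=
  Finset.univ.filter fun u => u ∉ closedNbhdSet G X ∧ ∃ w, G.Adj u w ∧ w ∉ closedNbhdSet G X

lemma mem_active {u : V} : u ∈ active G X ↔
    u ∉ closedNbhdSet G X ∧ ∃ w, G.Adj u w ∧ w ∉ closedNbhdSet G X := by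
  simp [active]

lemma isPlayable_iff : IsPlayable G X v ↔ Playable G (active G X) v := by
  constructor
  · rintro ⟨u, hvu, hu⟩
    exact ⟨u, mem_active.2 hu, hvu⟩
  · rintro ⟨u, hu, hvu⟩
    exact ⟨u, hvu, mem_active.1 hu⟩

lemma isolateFree_active : IsolateFree G (active G X) := by
  intro u hu
  obtain ⟨hu, w, huw, hw⟩ := mem_active.1 hu
  exact ⟨w, mem_active.2 ⟨hw, u, huw.symm, hu⟩, huw⟩

lemma active_insert : active G (insert v X) = residual G (active G X) v := by
  ext u
  simp only [mem_residual, mem_active, notMem_closedNbhdSet_insert]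
  constructor
  · rintro ⟨⟨hu, hvu⟩, w, huw, hw, hvw⟩
    exact ⟨⟨hu, w, huw, hw⟩, hvu, w, ⟨hw, u, huw.symm, hu⟩, huw, hvw⟩
  · rintro ⟨⟨hu, -⟩, hvu, w, ⟨hw, -⟩, huw, hvw⟩
    exact ⟨⟨hu, hvu⟩, w, huw, hw, hvw⟩

theorem isoGameVal_le_potential (hG : G.IsAcyclic) (k : ℕ) (X : Set V) (A : Finset V)
    (hA : Guards G (active G X) A) :
    22 * isoGameVal G k true X ≤ potential G (active G X) A := by
  induction k using Nat.strong_induction_on generalizing X A with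
  | _ k ih =>
    match k with
    | 0 => simp [isoGameVal]
    | k + 1 =>
      by_cases hp : ∃ v, IsPlayable G X v
      · obtain ⟨u, hu⟩ := hp
        have hne : (active G X).Nonempty := by
          obtain ⟨w, hw, -⟩ := isPlayable_iff.1 hu
          exact ⟨w, hw⟩
        obtain ⟨v, hv, h22, h44⟩ := dominatorProgress hG isolateFree_active hne hA
        have hdom := isoGameVal_dominator_le k (isPlayable_iff.2 hv)
        match k with
        | 0 =>
          simp only [isoGameVal] at hdom ⊢
          omega
        | j + 1 =>
          have hst := isoGameVal_staller_le (X := insert v X) j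
            ((potential G (active G X) A - 22) / 22) fun x hx => by
              rw [isPlayable_iff, active_insert] at hx
              obtain ⟨B, hB, hpot⟩ := h44 x hx
              rw [← active_insert, ← active_insert] at hB hpot
              have := ih j (by omega) _ B hB
              omega
          omega
      · simp [isoGameVal, hp]

end Game

end IsolationGame

/-- Theorem 4.3: if `T` is a tree of order `n ≥ 3`, then `ι_g(T) ≤ (5/11) n`. -/
theorem tree_game_isolation_five_elevenths {V : Type*} [Fintype V] (G : SimpleGraph V)
    (hT : G.IsTree) (hn : 3 ≤ Fintype.card V) :
    11 * iotaGame G ≤ 5 * Fintype.card V := by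
  classical
  have : Nontrivial V := Fintype.one_lt_card_iff_nontrivial.1 (by omega)
  have hact : IsolationGame.active G ∅ = Finset.univ := by
    refine Finset.eq_univ_of_forall fun u => IsolationGame.mem_active.2 ?_
    obtain ⟨w, hw⟩ := hT.connected.preconnected.exists_adj_of_nontrivial u
    simpa [closedNbhdSet] using ⟨w, hw⟩
  have hpair : ∀ u w, ¬ IsolationGame.IsPair G Finset.univ u w := by
    rintro u w ⟨-, -, -, hu, hw⟩
    have hclosed : ∀ x, G.Reachable u x → x = u ∨ x = w := by
      have hwalk : ∀ a x, G.Walk a x → a = u ∨ a = w → x = u ∨ x = w := by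
        intro a x p
        induction p with
        | nil => exact id
        | cons hab _ ih =>
          rintro (rfl | rfl)
          · exact ih (Or.inr (hu _ (Finset.mem_univ _) hab))
          · exact ih (Or.inl (hw _ (Finset.mem_univ _) hab))
      rintro x ⟨p⟩
      exact hwalk u x p (Or.inl rfl)
    have huniv : (Finset.univ : Finset V) ⊆ {u, w} := fun x _ => by
      simpa using hclosed x (hT.connected.preconnected u x)
    have := (Finset.card_le_card huniv).trans Finset.card_le_two
    rw [Finset.card_univ] at this
    omega
  have h := IsolationGame.isoGameVal_le_potential hT.isAcyclic (Fintype.card V) ∅ ∅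
    (by rw [hact]; intro y hy; simp at hy)
  rw [hact] at h
  have hexp : IsolationGame.exposed G Finset.univ ∅ = ∅ := by
    simp [IsolationGame.exposed, hpair]
  simp only [IsolationGame.potential, hexp, Finset.card_empty, Finset.card_univ] at h
  unfold iotaGame
  omega
end
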